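/- arXiv:1405.1840 — 2 statements merged into one kernel-verified Lean document; each statement's English description precedes it below -/
import Mathlib

section
/- Let (𝓑; B₁, B₂) be a boundary triplet for A₀*, let 𝓚 be a Hilbert space, let W₁, W₂ ∈ 𝓛(𝓑; 𝓚) be bounded, and let A := A₀*|_{dom(A)} with dom(A) = { x ∈ dom(A₀*) : W₁B₁x + W₂B₂x = 0 }. Then the adjoint A* is dissipative if and only if the operator inequality W₁W₂* + W₂W₁* ≥ 0 holds in 𝓚 (i.e., Re⟨W₂*k, W₁*k⟩_𝓑 ≥ 0 for all k ∈ 𝓚), and A* is skew-symmetric (Re⟨A*x, x⟩_X = 0 for all x ∈ dom(A*)) if and only if W₁W₂* + W₂W₁* = 0. -/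
open scoped ComplexInnerProductSpace

noncomputable section

/-- A boundary triplet `(𝓑; B₁, B₂)` for the operator `T` (to be taken as `T = A₀*`):
a Hilbert space `B` and two linear maps `B₁ B₂ : dom T → B`, bounded with respect to the
graph norm of `T`, such that `x ↦ (B₁ x, B₂ x)` is onto `B × B` and the abstract Green
identity `⟪Tx, x̃⟫ + ⟪x, Tx̃⟫ = ⟪B₁x, B₂x̃⟫ + ⟪B₂x, B₁x̃⟫` holds. -/
structure BoundaryTriplet {X : Type*} [NormedAddCommGroup X] [InnerProductSpace ℂ X]
    (B : Type*) [NormedAddCommGroup B] [InnerProductSpace ℂ B]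
    (T : X →ₗ.[ℂ] X) where
  B₁ : T.domain →ₗ[ℂ] B
  B₂ : T.domain →ₗ[ℂ] B
  bounded₁ : ∃ C : ℝ, ∀ x : T.domain, ‖B₁ x‖ ≤ C * (‖(x : X)‖ + ‖T x‖)
  bounded₂ : ∃ C : ℝ, ∀ x : T.domain, ‖B₂ x‖ ≤ C * (‖(x : X)‖ + ‖T x‖)
  surjective : Function.Surjective fun x : T.domain => (B₁ x, B₂ x)
  green : ∀ x y : T.domain,
    ⟪T x, (y : X)⟫ + ⟪(x : X), T y⟫ = ⟪B₁ x, B₂ y⟫ + ⟪B₂ x, B₁ y⟫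

/-- Polarization: a skew-symmetric partial operator satisfies `⟪Sx, y⟫ = -⟪x, Sy⟫`. -/
theorem LinearPMap.inner_eq_neg_of_re_inner_self_eq_zero
    {X : Type*} [NormedAddCommGroup X] [InnerProductSpace ℂ X] {S : X →ₗ.[ℂ] X}
    (hS : ∀ x : S.domain, (⟪S x, (x : X)⟫ : ℂ).re = 0) (x y : S.domain) :
    (⟪S x, (y : X)⟫ : ℂ) = -⟪(x : X), S y⟫ := by
  have hre (u v : S.domain) : (⟪S u, (v : X)⟫ : ℂ).re + (⟪(u : X), S v⟫ : ℂ).re = 0 := by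
    have h := hS (u + v)
    rw [S.map_add, Submodule.coe_add, inner_add_left, inner_add_right, inner_add_right] at h
    have hsymm : (⟪S v, (u : X)⟫ : ℂ).re = (⟪(u : X), S v⟫ : ℂ).re :=
      inner_re_symm (𝕜 := ℂ) _ _
    simp only [Complex.add_re, hS u, hS v, hsymm] at h
    linarith
  have him := hre x (Complex.I • y)
  rw [S.map_smul, Submodule.coe_smul, inner_smul_right, inner_smul_right] at him
  simp only [Complex.mul_re, Complex.I_re, Complex.I_im] at him
  have hre := hre x y
  apply Complex.ext
  · rw [Complex.neg_re]; linarith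
  · rw [Complex.neg_im]; linarith

/-- A densely defined skew-symmetric operator `S` satisfies `-S ⊆ S*`. -/
theorem LinearPMap.exists_adjoint_apply_eq_neg_of_skew
    {X : Type*} [NormedAddCommGroup X] [InnerProductSpace ℂ X] [CompleteSpace X]
    {S : X →ₗ.[ℂ] X} (hdense : Dense (S.domain : Set X))
    (hS : ∀ x : S.domain, (⟪S x, (x : X)⟫ : ℂ).re = 0) (x : S.domain) :
    ∃ z : S.adjoint.domain, (z : X) = x ∧ S.adjoint z = -S x := by
  have h (y : S.domain) : (⟪-S x, (y : X)⟫ : ℂ) = ⟪(x : X), S y⟫ := by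
    rw [inner_neg_left, S.inner_eq_neg_of_re_inner_self_eq_zero hS, neg_neg]
  exact ⟨⟨x, S.mem_adjoint_domain_of_exists _ ⟨_, h⟩⟩, rfl,
    LinearPMap.adjoint_apply_eq hdense _ h⟩

namespace BoundaryTriplet

variable {X : Type*} [NormedAddCommGroup X] [InnerProductSpace ℂ X]
  {B : Type*} [NormedAddCommGroup B] [InnerProductSpace ℂ B]
  {K : Type*} [NormedAddCommGroup K] [InnerProductSpace ℂ K]

theorem re_inner_apply_self {T : X →ₗ.[ℂ] X} (BT : BoundaryTriplet B T) (x : T.domain) :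
    (⟪T x, (x : X)⟫ : ℂ).re = (⟪BT.B₁ x, BT.B₂ x⟫ : ℂ).re := by
  have h := congrArg Complex.re (BT.green x x)
  have hT : (⟪(x : X), T x⟫ : ℂ).re = (⟪T x, (x : X)⟫ : ℂ).re :=
      inner_re_symm (𝕜 := ℂ) _ _
  have hB : (⟪BT.B₂ x, BT.B₁ x⟫ : ℂ).re = (⟪BT.B₁ x, BT.B₂ x⟫ : ℂ).re :=
      inner_re_symm (𝕜 := ℂ) _ _
  rw [Complex.add_re, Complex.add_re, hT, hB] at h
  linarith

/-- The boundary maps vanish at every `x` annihilated by the Green form. -/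
theorem eq_zero_of_green_eq_zero {T : X →ₗ.[ℂ] X} (BT : BoundaryTriplet B T) {x : T.domain}
    (h : ∀ y : T.domain, (⟪T x, (y : X)⟫ : ℂ) + ⟪(x : X), T y⟫ = 0) :
    BT.B₁ x = 0 ∧ BT.B₂ x = 0 := by
  obtain ⟨y, hy⟩ := BT.surjective (BT.B₂ x, BT.B₁ x)
  obtain ⟨h₁, h₂⟩ := Prod.mk.inj hy
  have hg := congrArg Complex.re ((BT.green x y).symm.trans (h y))
  rw [h₁, h₂, Complex.add_re, Complex.zero_re] at hg
  have e₁ : (⟪BT.B₁ x, BT.B₁ x⟫ : ℂ).re = ‖BT.B₁ x‖ ^ 2 := inner_self_eq_norm_sq (𝕜 := ℂ) _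
  have e₂ : (⟪BT.B₂ x, BT.B₂ x⟫ : ℂ).re = ‖BT.B₂ x‖ ^ 2 := inner_self_eq_norm_sq (𝕜 := ℂ) _
  rw [e₁, e₂] at hg
  constructor <;> rw [← norm_eq_zero] <;> nlinarith [sq_nonneg ‖BT.B₁ x‖, sq_nonneg ‖BT.B₂ x‖]

/-- The restriction of `T` to `{x : W₁ B₁ x + W₂ B₂ x = 0}`. -/
def restrict {T : X →ₗ.[ℂ] X} (BT : BoundaryTriplet B T) (W₁ W₂ : B →L[ℂ] K) : X →ₗ.[ℂ] X :=
  T.domRestrict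
    ((LinearMap.ker ((W₁ : B →ₗ[ℂ] K) ∘ₗ BT.B₁ + (W₂ : B →ₗ[ℂ] K) ∘ₗ BT.B₂)).map
      T.domain.subtype)

section Restrict

variable {T : X →ₗ.[ℂ] X} (BT : BoundaryTriplet B T) (W₁ W₂ : B →L[ℂ] K)

theorem exists_of_mem_restrict (x : (BT.restrict W₁ W₂).domain) :
    ∃ z : T.domain, (z : X) = x ∧ W₁ (BT.B₁ z) + W₂ (BT.B₂ z) = 0 ∧
      BT.restrict W₁ W₂ x = T z := by
  obtain ⟨x, ⟨z, hz, rfl⟩, hx⟩ := x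
  exact ⟨z, rfl, hz, LinearPMap.domRestrict_apply rfl⟩

theorem exists_restrict_apply_eq {z : T.domain} (hz : W₁ (BT.B₁ z) + W₂ (BT.B₂ z) = 0) :
    ∃ x : (BT.restrict W₁ W₂).domain, (x : X) = z ∧ BT.restrict W₁ W₂ x = T z :=
  ⟨⟨z, ⟨z, hz, rfl⟩, z.2⟩, rfl, LinearPMap.domRestrict_apply rfl⟩

end Restrict

variable [CompleteSpace X]

section Adjoint

variable {A₀ : X →ₗ.[ℂ] X} (hdense : Dense (A₀.domain : Set X))
  (hskew : ∀ x : A₀.domain, (⟪A₀ x, (x : X)⟫ : ℂ).re = 0)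
  (BT : BoundaryTriplet B A₀.adjoint) (W₁ W₂ : B →L[ℂ] K)

include hdense hskew

/-- The restriction of `A₀*` extends `-A₀`. -/
theorem exists_restrict_apply_eq_neg (x : A₀.domain) :
    ∃ z : (BT.restrict W₁ W₂).domain, (z : X) = x ∧ BT.restrict W₁ W₂ z = -A₀ x := by
  obtain ⟨z, hzx, hz⟩ := LinearPMap.exists_adjoint_apply_eq_neg_of_skew hdense hskew x
  obtain ⟨h₁, h₂⟩ := BT.eq_zero_of_green_eq_zero (x := z) fun y => by
    rw [hz, hzx, inner_neg_left, neg_add_eq_zero]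
    exact ((LinearPMap.adjoint_isFormalAdjoint hdense).symm x y)
  obtain ⟨w, hw, hw'⟩ := BT.exists_restrict_apply_eq W₁ W₂ (z := z) (by simp [h₁, h₂])
  exact ⟨w, hw.trans hzx, hw'.trans hz⟩

theorem dense_restrict_domain : Dense ((BT.restrict W₁ W₂).domain : Set X) :=
  hdense.mono fun x hx => by
    obtain ⟨z, hz, -⟩ := BT.exists_restrict_apply_eq_neg hdense hskew W₁ W₂ ⟨x, hx⟩
    change (z : X) = x at hz
    exact hz ▸ z.2

/-- The adjoint of the restriction is contained in `-A₀*`. -/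
theorem exists_adjoint_restrict_apply_eq_neg (y : (BT.restrict W₁ W₂).adjoint.domain) :
    ∃ z : A₀.adjoint.domain, (z : X) = y ∧
      (BT.restrict W₁ W₂).adjoint y = -A₀.adjoint z := by
  have h (x : A₀.domain) :
      (⟪-(BT.restrict W₁ W₂).adjoint y, (x : X)⟫ : ℂ) = ⟪(y : X), A₀ x⟫ := by
    obtain ⟨z, hzx, hz⟩ := BT.exists_restrict_apply_eq_neg hdense hskew W₁ W₂ x
    rw [inner_neg_left, ← hzx, LinearPMap.adjoint_isFormalAdjoint
      (BT.dense_restrict_domain hdense hskew W₁ W₂) y z, hz, inner_neg_right, neg_neg]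
  refine ⟨⟨y, A₀.mem_adjoint_domain_of_exists _ ⟨_, h⟩⟩, rfl, ?_⟩
  rw [LinearPMap.adjoint_apply_eq hdense _ h, neg_neg]

variable [CompleteSpace B] [CompleteSpace K]

/-- The boundary values of an element of the domain of the adjoint of the restriction lie in the
closure of the range of `k ↦ (W₁* k, W₂* k)`. -/
theorem mem_closure_range_of_mem_adjoint_restrict {y : (BT.restrict W₁ W₂).adjoint.domain}
    {z : A₀.adjoint.domain} (hzy : (z : X) = y)
    (hz : (BT.restrict W₁ W₂).adjoint y = -A₀.adjoint z) :
    (BT.B₂ z, BT.B₁ z) ∈ closure (Set.range fun k : K => (ContinuousLinearMap.adjoint W₁ k, ContinuousLinearMap.adjoint W₂ k)) := by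
  let V : K →ₗ[ℂ] WithLp 2 (B × B) := (WithLp.linearEquiv 2 ℂ (B × B)).symm.toLinearMap ∘ₗ
    (ContinuousLinearMap.adjoint W₁ : K →ₗ[ℂ] B).prod (ContinuousLinearMap.adjoint W₂ : K →ₗ[ℂ] B)
  have hmem : WithLp.toLp 2 (BT.B₂ z, BT.B₁ z) ∈ (LinearMap.range V)ᗮᗮ := by
    rw [Submodule.mem_orthogonal]
    intro v hv
    have hker : W₁ v.fst + W₂ v.snd = 0 := by
      refine ext_inner_left ℂ fun k => ?_
      have h := (Submodule.mem_orthogonal _ _).1 hv (V k) ⟨k, rfl⟩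
      rw [WithLp.prod_inner_apply] at h
      rw [inner_add_right, inner_zero_right, ← ContinuousLinearMap.adjoint_inner_left,
        ← ContinuousLinearMap.adjoint_inner_left]
      exact h
    obtain ⟨x, hx⟩ := BT.surjective (v.fst, v.snd)
    obtain ⟨h₁, h₂⟩ := Prod.mk.inj hx
    obtain ⟨w, hwx, hw⟩ := BT.exists_restrict_apply_eq W₁ W₂ (z := x) (by rw [h₁, h₂, hker])
    have hadj := (LinearPMap.adjoint_isFormalAdjoint
      (BT.dense_restrict_domain hdense hskew W₁ W₂)).symm w y
    have hg := BT.green x z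
    rw [← hw, ← hwx, hzy, hadj, hz, inner_neg_right, neg_add_cancel, h₁, h₂] at hg
    rw [WithLp.prod_inner_apply]
    exact hg.symm
  rw [Submodule.orthogonal_orthogonal_eq_closure, ← SetLike.mem_coe,
    Submodule.topologicalClosure_coe] at hmem
  refine map_mem_closure (f := WithLp.ofLp) (WithLp.prod_continuous_ofLp 2 B B) hmem ?_
  rintro _ ⟨k, rfl⟩
  exact ⟨k, rfl⟩

/-- Every `(W₂* k, W₁* k)` is the boundary value of an element of the domain of the adjoint of the
restriction. -/
theorem exists_mem_adjoint_restrict (k : K) :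
    ∃ (y : (BT.restrict W₁ W₂).adjoint.domain) (z : A₀.adjoint.domain), (z : X) = y ∧
      (BT.restrict W₁ W₂).adjoint y = -A₀.adjoint z ∧
      BT.B₁ z = ContinuousLinearMap.adjoint W₂ k ∧ BT.B₂ z = ContinuousLinearMap.adjoint W₁ k := by
  obtain ⟨z, hz⟩ := BT.surjective (ContinuousLinearMap.adjoint W₂ k, ContinuousLinearMap.adjoint W₁ k)
  obtain ⟨h₁, h₂⟩ := Prod.mk.inj hz
  have h (x : (BT.restrict W₁ W₂).domain) :
      (⟪-A₀.adjoint z, (x : X)⟫ : ℂ) = ⟪(z : X), BT.restrict W₁ W₂ x⟫ := by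
    obtain ⟨w, hwx, hw, hx⟩ := BT.exists_of_mem_restrict W₁ W₂ x
    have hg := BT.green z w
    rw [h₁, h₂, ContinuousLinearMap.adjoint_inner_left, ContinuousLinearMap.adjoint_inner_left,
      ← inner_add_right, add_comm (W₂ _), hw, inner_zero_right] at hg
    rw [hx, ← hwx, inner_neg_left]
    exact neg_eq_of_add_eq_zero_right hg
  exact ⟨⟨z, LinearPMap.mem_adjoint_domain_of_exists _ ⟨_, h⟩⟩, z, rfl,
    LinearPMap.adjoint_apply_eq (BT.dense_restrict_domain hdense hskew W₁ W₂) _ h, h₁, h₂⟩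

/-- The numbers `-Re ⟪A* y, y⟫` lie in a closed set iff the numbers `Re ⟪W₂* k, W₁* k⟫` do. -/
theorem forall_neg_re_inner_adjoint_restrict_mem_iff {P : Set ℝ} (hP : IsClosed P) :
    (∀ y : (BT.restrict W₁ W₂).adjoint.domain,
        -(⟪(BT.restrict W₁ W₂).adjoint y, (y : X)⟫ : ℂ).re ∈ P) ↔
      ∀ k : K, (⟪ContinuousLinearMap.adjoint W₂ k, ContinuousLinearMap.adjoint W₁ k⟫ : ℂ).re ∈ P := by
  have key {y : (BT.restrict W₁ W₂).adjoint.domain} {z : A₀.adjoint.domain} (hzy : (z : X) = y)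
      (hz : (BT.restrict W₁ W₂).adjoint y = -A₀.adjoint z) :
      -(⟪(BT.restrict W₁ W₂).adjoint y, (y : X)⟫ : ℂ).re = (⟪BT.B₁ z, BT.B₂ z⟫ : ℂ).re := by
    rw [hz, ← hzy, inner_neg_left, Complex.neg_re, neg_neg, BT.re_inner_apply_self]
  constructor
  · intro h k
    obtain ⟨y, z, hzy, hz, h₁, h₂⟩ := BT.exists_mem_adjoint_restrict hdense hskew W₁ W₂ k
    rw [← h₁, ← h₂, ← key hzy hz]
    exact h y
  · intro h y
    obtain ⟨z, hzy, hz⟩ := BT.exists_adjoint_restrict_apply_eq_neg hdense hskew W₁ W₂ y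
    rw [key hzy hz]
    have hclosed : IsClosed {p : B × B | (⟪p.2, p.1⟫ : ℂ).re ∈ P} :=
      hP.preimage (Complex.continuous_re.comp (continuous_snd.inner continuous_fst))
    exact closure_minimal (by rintro _ ⟨k, rfl⟩; exact h k) hclosed
      (BT.mem_closure_range_of_mem_adjoint_restrict hdense hskew W₁ W₂ hzy hz)

end Adjoint

end BoundaryTriplet

/-- `W₁ W₂* + W₂ W₁*` vanishes iff its quadratic form `2 Re ⟪W₂* k, W₁* k⟫` does. -/
theorem ContinuousLinearMap.comp_adjoint_add_comp_adjoint_eq_zero_iff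
    {B : Type*} [NormedAddCommGroup B] [InnerProductSpace ℂ B] [CompleteSpace B]
    {K : Type*} [NormedAddCommGroup K] [InnerProductSpace ℂ K] [CompleteSpace K]
    (W₁ W₂ : B →L[ℂ] K) :
    W₁.comp (ContinuousLinearMap.adjoint W₂) + W₂.comp (ContinuousLinearMap.adjoint W₁) = 0 ↔
      ∀ k : K, (⟪ContinuousLinearMap.adjoint W₂ k, ContinuousLinearMap.adjoint W₁ k⟫ : ℂ).re = 0 := by
  have hform (k : K) : (⟪(W₁.comp (ContinuousLinearMap.adjoint W₂) + W₂.comp (ContinuousLinearMap.adjoint W₁)) k, k⟫ : ℂ) =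
      (2 * (⟪ContinuousLinearMap.adjoint W₂ k, ContinuousLinearMap.adjoint W₁ k⟫ : ℂ).re : ℝ) := by
    rw [add_apply, comp_apply, comp_apply, inner_add_left, ← adjoint_inner_right W₁,
      ← adjoint_inner_right W₂, ← inner_conj_symm (ContinuousLinearMap.adjoint W₁ k), Complex.add_conj]
  constructor
  · intro h k
    have := hform k
    rw [h, zero_apply, inner_zero_left, eq_comm, Complex.ofReal_eq_zero] at this
    linarith
  · intro h
    have hz : ((W₁.comp (ContinuousLinearMap.adjoint W₂) + W₂.comp (ContinuousLinearMap.adjoint W₁) : K →L[ℂ] K) : K →ₗ[ℂ] K) = 0 :=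
      (inner_map_self_eq_zero _).1 fun k => by
        rw [ContinuousLinearMap.coe_coe, hform, h, mul_zero, Complex.ofReal_zero]
    ext k
    exact LinearMap.congr_fun hz k

/-- With `A` the restriction of `A₀*` to `{x : W₁ B₁ x + W₂ B₂ x = 0}`,
the adjoint `A*` is dissipative iff `W₁ W₂* + W₂ W₁* ≥ 0` in `𝓚` (i.e.
`Re ⟪W₂* k, W₁* k⟫ ≥ 0` for all `k`), and `A*` is skew-symmetric iff
`W₁ W₂* + W₂ W₁* = 0`. -/
theorem statement9
    {X : Type*} [NormedAddCommGroup X] [InnerProductSpace ℂ X] [CompleteSpace X]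
    {B : Type*} [NormedAddCommGroup B] [InnerProductSpace ℂ B] [CompleteSpace B]
    {K : Type*} [NormedAddCommGroup K] [InnerProductSpace ℂ K] [CompleteSpace K]
    (A₀ : X →ₗ.[ℂ] X) (hdense : Dense (A₀.domain : Set X)) (hclosed : A₀.IsClosed)
    (hskew : ∀ x : A₀.domain, (⟪A₀ x, (x : X)⟫ : ℂ).re = 0)
    (BT : BoundaryTriplet B A₀.adjoint)
    (W₁ W₂ : B →L[ℂ] K)
    (A : X →ₗ.[ℂ] X)
    (hA : A = A₀.adjoint.domRestrict
      ((LinearMap.ker ((W₁ : B →ₗ[ℂ] K) ∘ₗ BT.B₁ + (W₂ : B →ₗ[ℂ] K) ∘ₗ BT.B₂)).map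
        A₀.adjoint.domain.subtype))
    : ((∀ x : A.adjoint.domain, (⟪A.adjoint x, (x : X)⟫ : ℂ).re ≤ 0) ↔
        ∀ k : K, 0 ≤ (⟪ContinuousLinearMap.adjoint W₂ k, ContinuousLinearMap.adjoint W₁ k⟫ : ℂ).re) ∧
      ((∀ x : A.adjoint.domain, (⟪A.adjoint x, (x : X)⟫ : ℂ).re = 0) ↔
        W₁.comp (ContinuousLinearMap.adjoint W₂) + W₂.comp (ContinuousLinearMap.adjoint W₁) = 0) := by
  change A = BT.restrict W₁ W₂ at hA
  subst hA
  constructor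
  · simpa using BT.forall_neg_re_inner_adjoint_restrict_mem_iff hdense hskew W₁ W₂
      (isClosed_Ici (a := (0 : ℝ)))
  · rw [ContinuousLinearMap.comp_adjoint_add_comp_adjoint_eq_zero_iff]
    simpa using BT.forall_neg_re_inner_adjoint_restrict_mem_iff hdense hskew W₁ W₂
      (isClosed_singleton (x := (0 : ℝ)))
end
end

section
/- Let (𝓑; B₁, B₂) be a boundary triplet for A₀*, let 𝓚 be a Hilbert space, let W₁, W₂ ∈ 𝓛(𝓑; 𝓚) be bounded, and let A := A₀*|_{dom(A)} with dom(A) = { x ∈ dom(A₀*) : W₁B₁x + W₂B₂x = 0 }. Then A generates a strongly continuous contraction semigroup on X (equivalently, since A is closed and densely defined: A is maximal dissipative) if and only if A is dissipative and the operator inequality W₁W₂* + W₂W₁* ≥ 0 holds in 𝓚. -/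
open scoped ComplexInnerProductSpace

noncomputable section

/-- A relation `R` in a Hilbert space `H` (a linear subspace of `H × H`) is dissipative
if `Re ⟪r₁, r₂⟫ ≤ 0` for all `(r₁, r₂) ∈ R`. -/
def IsDissipativeRel {H : Type*} [NormedAddCommGroup H] [InnerProductSpace ℂ H]
    (R : Submodule ℂ (H × H)) : Prop :=
  ∀ r ∈ R, (⟪r.1, r.2⟫ : ℂ).re ≤ 0

/-- A relation is maximal dissipative if it is dissipative and has no proper extension to a
dissipative relation. -/
def IsMaximalDissipativeRel {H : Type*} [NormedAddCommGroup H] [InnerProductSpace ℂ H]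
    (R : Submodule ℂ (H × H)) : Prop :=
  IsDissipativeRel R ∧
    ∀ R' : Submodule ℂ (H × H), IsDissipativeRel R' → R ≤ R' → R' = R

open ContinuousLinearMap (adjoint)

section Relation

variable {H : Type*} [NormedAddCommGroup H] [InnerProductSpace ℂ H]

theorem re_inner_eq_norm_sq_sub_norm_sq (x y : H) :
    (⟪x, y⟫ : ℂ).re = (‖x + y‖ ^ 2 - ‖x - y‖ ^ 2) / 4 := by
  have h := re_inner_eq_norm_add_mul_self_sub_norm_sub_mul_self_div_four (𝕜 := ℂ) x y
  simp only [RCLike.re_to_complex] at h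
  rw [h]
  ring

theorem re_inner_nonpos_iff_norm_add_le_norm_sub (x y : H) :
    (⟪x, y⟫ : ℂ).re ≤ 0 ↔ ‖x + y‖ ≤ ‖x - y‖ := by
  rw [re_inner_eq_norm_sq_sub_norm_sq, ← sq_le_sq₀ (norm_nonneg _) (norm_nonneg _)]
  constructor <;> intro h <;> linarith

theorem re_inner_nonneg_iff_norm_sub_le_norm_add (x y : H) :
    0 ≤ (⟪x, y⟫ : ℂ).re ↔ ‖x - y‖ ≤ ‖x + y‖ := by
  rw [re_inner_eq_norm_sq_sub_norm_sq, ← sq_le_sq₀ (norm_nonneg _) (norm_nonneg _)]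
  constructor <;> intro h <;> linarith

theorem norm_le_norm_sub_of_norm_add_le (x y : H) (h : ‖x + y‖ ≤ ‖x - y‖) :
    ‖(x, y)‖ ≤ ‖x - y‖ := by
  have two_smul_norm (z : H) : ‖(2 : ℂ) • z‖ = 2 * ‖z‖ := by simp [norm_smul]
  have hx : (2 : ℂ) • x = (x + y) + (x - y) := by rw [two_smul]; abel
  have hy : (2 : ℂ) • y = (x + y) - (x - y) := by rw [two_smul]; abel
  have h₁ := two_smul_norm x ▸ hx ▸ norm_add_le (x + y) (x - y)
  have h₂ := two_smul_norm y ▸ hy ▸ norm_sub_le (x + y) (x - y)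
  rw [Prod.norm_def]
  exact max_le (by simp only; linarith) (by simp only; linarith)

/-- A closed dissipative relation is the graph of a contraction `x - y ↦ x + y` defined on a
closed subspace, which is everything as soon as its orthogonal complement is trivial. -/
theorem IsDissipativeRel.exists_sub_eq [CompleteSpace H] {C : Submodule ℂ (H × H)}
    (hC : IsDissipativeRel C) (hclosed : IsClosed (C : Set (H × H)))
    (horth : ∀ d : H, (∀ b ∈ C, (⟪b.1 - b.2, d⟫ : ℂ) = 0) → d = 0) (w : H) :
    ∃ b ∈ C, b.1 - b.2 = w := by
  let f : C →L[ℂ] H :=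
    (ContinuousLinearMap.fst ℂ H H - ContinuousLinearMap.snd ℂ H H).comp C.subtypeL
  have : CompleteSpace C := hclosed.completeSpace_coe
  have hanti : AntilipschitzWith 1 f := f.antilipschitz_of_bound fun x => by
    simpa [f] using norm_le_norm_sub_of_norm_add_le _ _
      ((re_inner_nonpos_iff_norm_add_le_norm_sub _ _).1 (hC x x.2))
  have hrange : IsClosed (f.range : Set H) := by
    rw [LinearMap.coe_range]
    exact hanti.isClosed_range f.uniformContinuous
  have : CompleteSpace f.range := hrange.completeSpace_coe
  have htop : f.range = ⊤ := by
    rw [← Submodule.orthogonal_eq_bot_iff, Submodule.eq_bot_iff]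
    intro d hd
    exact horth d fun b hb => (Submodule.mem_orthogonal _ _).1 hd _ ⟨⟨b, hb⟩, rfl⟩
  obtain ⟨b, hb⟩ : w ∈ f.range := htop ▸ Submodule.mem_top
  exact ⟨b, b.2, hb⟩

theorem IsDissipativeRel.isMaximalDissipativeRel {C : Submodule ℂ (H × H)}
    (hC : IsDissipativeRel C) (hsurj : ∀ w : H, ∃ b ∈ C, b.1 - b.2 = w) :
    IsMaximalDissipativeRel C := by
  refine ⟨hC, fun R hR hCR => le_antisymm (fun r hr => ?_) hCR⟩
  obtain ⟨b, hb, hbr⟩ := hsurj (r.1 - r.2)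
  have hsub : (r - b).1 - (r - b).2 = 0 := by
    rw [Prod.fst_sub, Prod.snd_sub, sub_sub_sub_comm, hbr, sub_self]
  have hle := norm_le_norm_sub_of_norm_add_le _ _ ((re_inner_nonpos_iff_norm_add_le_norm_sub _ _).1
    (hR (r - b) (R.sub_mem hr (hCR hb))))
  rw [hsub, norm_zero, norm_le_zero_iff, Prod.mk.eta, sub_eq_zero] at hle
  exact hle ▸ hb

theorem IsMaximalDissipativeRel.eq_zero_of_orthogonal {C : Submodule ℂ (H × H)}
    (hC : IsMaximalDissipativeRel C) (d : H) (hd : ∀ b ∈ C, (⟪b.1 - b.2, d⟫ : ℂ) = 0) :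
    d = 0 := by
  have hdiss : IsDissipativeRel (C ⊔ ℂ ∙ ((d, -d) : H × H)) := by
    intro r hr
    obtain ⟨b, hb, s, hs, rfl⟩ := Submodule.mem_sup.1 hr
    obtain ⟨c, rfl⟩ := Submodule.mem_span_singleton.1 hs
    rw [re_inner_nonpos_iff_norm_add_le_norm_sub]
    have hadd : (b + c • (d, -d)).1 + (b + c • (d, -d)).2 = b.1 + b.2 := by
      simp only [Prod.fst_add, Prod.snd_add, Prod.smul_mk, smul_neg]; abel
    have hsub : (b + c • (d, -d)).1 - (b + c • (d, -d)).2 = (b.1 - b.2) + (2 * c) • d := by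
      simp only [Prod.fst_add, Prod.snd_add, Prod.smul_mk, smul_neg, two_mul, add_smul]; abel
    rw [hadd, hsub]
    refine ((re_inner_nonpos_iff_norm_add_le_norm_sub _ _).1 (hC.1 b hb)).trans ?_
    have hpyth := norm_add_sq_eq_norm_sq_add_norm_sq_of_inner_eq_zero (𝕜 := ℂ) (b.1 - b.2)
      ((2 * c) • d) (by rw [inner_smul_right, hd b hb, mul_zero])
    rw [← sq_le_sq₀ (norm_nonneg _) (norm_nonneg _)]
    nlinarith [sq_nonneg ‖(2 * c) • d‖]
  have hmem : ((d, -d) : H × H) ∈ C :=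
    hC.2 _ hdiss le_sup_left ▸ Submodule.mem_sup_right (Submodule.mem_span_singleton_self _)
  have h := hd _ hmem
  rw [sub_neg_eq_add, ← two_smul ℂ d, inner_smul_left, mul_eq_zero, inner_self_eq_zero] at h
  exact h.resolve_left (by simp)

end Relation

section Kernel

variable {B : Type*} [NormedAddCommGroup B] [InnerProductSpace ℂ B] [CompleteSpace B]
  {K : Type*} [NormedAddCommGroup K] [InnerProductSpace ℂ K] [CompleteSpace K]

theorem re_inner_adjoint_nonneg_of_isMaximalDissipativeRel_ker (W₁ W₂ : B →L[ℂ] K)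
    (hmax : IsMaximalDissipativeRel (W₁.coprod W₂).ker) (k : K) :
    0 ≤ (⟪adjoint W₂ k, adjoint W₁ k⟫ : ℂ).re := by
  obtain ⟨b, hb, hbk⟩ := hmax.1.exists_sub_eq (W₁.coprod W₂).isClosed_ker
    hmax.eq_zero_of_orthogonal (adjoint W₁ k - adjoint W₂ k)
  have hb0 : W₁ b.1 + W₂ b.2 = 0 := by simpa using hb
  set p := adjoint W₁ k
  set q := adjoint W₂ k
  have horth : (⟪p, b.1⟫ : ℂ) + ⟪q, b.2⟫ = 0 := by
    rw [ContinuousLinearMap.adjoint_inner_left, ContinuousLinearMap.adjoint_inner_left,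
      ← inner_add_right, hb0, inner_zero_right]
  have hsum : (⟪p - q, p - q⟫ : ℂ) = -⟪p + q, b.1 + b.2⟫ := by
    nth_rewrite 2 [← hbk]
    simp only [inner_add_left, inner_sub_left, inner_add_right, inner_sub_right]
    linear_combination 2 * horth
  have hle : ‖p - q‖ * ‖p - q‖ ≤ ‖p + q‖ * ‖p - q‖ := by
    calc ‖p - q‖ * ‖p - q‖ = ‖(⟪p + q, b.1 + b.2⟫ : ℂ)‖ := by
          rw [← norm_neg (⟪p + q, b.1 + b.2⟫ : ℂ), ← hsum, inner_self_eq_norm_sq_to_K]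
          simp [sq]
      _ ≤ ‖p + q‖ * ‖b.1 + b.2‖ := norm_inner_le_norm _ _
      _ ≤ ‖p + q‖ * ‖p - q‖ := by
          gcongr
          exact hbk ▸ (re_inner_nonpos_iff_norm_add_le_norm_sub _ _).1 (hmax.1 b hb)
  rw [re_inner_nonneg_iff_norm_sub_le_norm_add, norm_sub_rev, add_comm]
  by_contra! hlt
  nlinarith [norm_nonneg (p + q)]

theorem eq_zero_of_orthogonal_ker (W₁ W₂ : B →L[ℂ] K)
    (hW : ∀ k : K, 0 ≤ (⟪adjoint W₂ k, adjoint W₁ k⟫ : ℂ).re) (d : B)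
    (hd : ∀ b ∈ (W₁.coprod W₂).ker, (⟪b.1 - b.2, d⟫ : ℂ) = 0) : d = 0 := by
  let V : WithLp 2 (B × B) →L[ℂ] K :=
    (W₁.coprod W₂).comp (WithLp.prodContinuousLinearEquiv 2 ℂ B B).toContinuousLinearMap
  have hV (k : K) : adjoint V k = WithLp.toLp 2 (adjoint W₁ k, adjoint W₂ k) := by
    refine ext_inner_right ℂ fun z => ?_
    rw [ContinuousLinearMap.adjoint_inner_left, WithLp.prod_inner_apply]
    simp [V, ContinuousLinearMap.adjoint_inner_left, inner_add_right]
  have hmem : WithLp.toLp 2 (d, -d) ∈ V.kerᗮ := by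
    rw [Submodule.mem_orthogonal]
    intro z hz
    rw [WithLp.prod_inner_apply]
    simpa [inner_sub_left, sub_eq_add_neg] using hd (WithLp.ofLp z) hz
  rw [ContinuousLinearMap.orthogonal_ker] at hmem
  have hclosed : IsClosed {z : WithLp 2 (B × B) | 0 ≤ (⟪z.snd, z.fst⟫ : ℂ).re} :=
    isClosed_le continuous_const (Complex.continuous_re.comp
      ((WithLp.sndL 2 ℂ B B).continuous.inner (WithLp.fstL 2 ℂ B B).continuous))
  have hnonneg : 0 ≤ (⟪-d, d⟫ : ℂ).re := by
    refine closure_minimal ?_ hclosed hmem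
    rintro _ ⟨k, rfl⟩
    simpa [hV] using hW k
  rw [inner_neg_left, Complex.neg_re] at hnonneg
  exact (re_inner_self_nonpos (𝕜 := ℂ)).1 (by simpa using hnonneg)

theorem isMaximalDissipativeRel_ker_coprod_iff (W₁ W₂ : B →L[ℂ] K) :
    IsMaximalDissipativeRel (W₁.coprod W₂).ker ↔
      IsDissipativeRel (W₁.coprod W₂).ker ∧
        ∀ k : K, 0 ≤ (⟪adjoint W₂ k, adjoint W₁ k⟫ : ℂ).re :=
  ⟨fun h => ⟨h.1, re_inner_adjoint_nonneg_of_isMaximalDissipativeRel_ker W₁ W₂ h⟩,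
    fun h => h.1.isMaximalDissipativeRel <| h.1.exists_sub_eq (W₁.coprod W₂).isClosed_ker
      (eq_zero_of_orthogonal_ker W₁ W₂ h.2)⟩

end Kernel

section SkewSymmetric

variable {X : Type*} [NormedAddCommGroup X] [InnerProductSpace ℂ X]

theorem LinearPMap.inner_add_inner_eq_zero_of_skew {A₀ : X →ₗ.[ℂ] X}
    (hskew : ∀ x : A₀.domain, (⟪A₀ x, (x : X)⟫ : ℂ).re = 0) (x y : A₀.domain) :
    (⟪A₀ x, (y : X)⟫ : ℂ) + ⟪(x : X), A₀ y⟫ = 0 := by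
  have hre (x y : A₀.domain) : ((⟪A₀ x, (y : X)⟫ : ℂ) + ⟪(x : X), A₀ y⟫).re = 0 := by
    have h := hskew (x + y)
    rw [LinearPMap.map_add, Submodule.coe_add, inner_add_left, inner_add_right,
      inner_add_right] at h
    simp only [Complex.add_re, hskew] at h
    have hsymm : (⟪(x : X), A₀ y⟫ : ℂ).re = (⟪A₀ y, (x : X)⟫ : ℂ).re :=
      inner_re_symm (𝕜 := ℂ) _ _
    rw [Complex.add_re, hsymm]
    linarith
  refine Complex.ext (hre x y) ?_
  have h := hre x (Complex.I • y)
  rw [LinearPMap.map_smul, Submodule.coe_smul, inner_smul_right, inner_smul_right,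
    ← mul_add, Complex.I_mul_re, neg_eq_zero] at h
  exact h

theorem eq_zero_of_re_le {V : Type*} [AddCommGroup V] [Module ℂ V] (f : V →ₗ[ℂ] ℂ) (M : ℝ)
    (hf : ∀ x, (f x).re ≤ M) (x : V) : f x = 0 := by
  by_contra hx
  have h := hf ((((M + 1 : ℝ) : ℂ) / f x) • x)
  rw [map_smul, smul_eq_mul, div_mul_cancel₀ _ hx, Complex.ofReal_re] at h
  linarith

variable [CompleteSpace X] {A₀ : X →ₗ.[ℂ] X}

theorem LinearPMap.exists_adjoint_eq_neg_of_skew (hdense : Dense (A₀.domain : Set X))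
    (hskew : ∀ x : A₀.domain, (⟪A₀ x, (x : X)⟫ : ℂ).re = 0) (x : A₀.domain) :
    ∃ y : A₀.adjoint.domain, (y : X) = x ∧ A₀.adjoint y = -A₀ x := by
  have h (z : A₀.domain) : (⟪-A₀ x, (z : X)⟫ : ℂ) = ⟪(x : X), A₀ z⟫ := by
    rw [inner_neg_left, neg_eq_iff_add_eq_zero]
    exact LinearPMap.inner_add_inner_eq_zero_of_skew hskew x z
  exact ⟨⟨x, LinearPMap.mem_adjoint_domain_of_exists _ ⟨_, h⟩⟩, rfl,
    LinearPMap.adjoint_apply_eq hdense _ h⟩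

/-- A dissipative relation extending `-A₀`, for `A₀` skew-symmetric, is a restriction of `A₀*`. -/
theorem IsDissipativeRel.le_graph_adjoint (hdense : Dense (A₀.domain : Set X))
    (hskew : ∀ x : A₀.domain, (⟪A₀ x, (x : X)⟫ : ℂ).re = 0) {R : Submodule ℂ (X × X)}
    (hR : IsDissipativeRel R) (hle : ∀ x : A₀.domain, ((x : X), -A₀ x) ∈ R) :
    R ≤ A₀.adjoint.graph := by
  rintro ⟨u, v⟩ huv
  let f : A₀.domain →ₗ[ℂ] ℂ :=
    (innerₛₗ ℂ v).comp A₀.domain.subtype - (innerₛₗ ℂ u).comp A₀.toFun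
  have hf (x : A₀.domain) : (f x).re ≤ -(⟪u, v⟫ : ℂ).re := by
    have h := hR _ (R.add_mem huv (hle x))
    have hx := hskew x
    have hsymm : (⟪(x : X), v⟫ : ℂ).re = (⟪v, (x : X)⟫ : ℂ).re :=
      inner_re_symm (𝕜 := ℂ) _ _
    have hsymm' : (⟪(x : X), A₀ x⟫ : ℂ).re = (⟪A₀ x, (x : X)⟫ : ℂ).re :=
      inner_re_symm (𝕜 := ℂ) _ _
    simp only [Prod.mk_add_mk, inner_add_left, inner_add_right, inner_neg_right, Complex.add_re,
      Complex.neg_re] at h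
    change ((⟪v, (x : X)⟫ : ℂ) - ⟪u, A₀ x⟫).re ≤ _
    rw [Complex.sub_re]
    linarith
  have h (x : A₀.domain) : (⟪v, (x : X)⟫ : ℂ) = ⟪u, A₀ x⟫ :=
    sub_eq_zero.1 (eq_zero_of_re_le f _ hf x)
  exact (LinearPMap.mem_graph_iff _).2
    ⟨⟨u, LinearPMap.mem_adjoint_domain_of_exists _ ⟨v, h⟩⟩, rfl,
      LinearPMap.adjoint_apply_eq hdense _ h⟩

end SkewSymmetric

namespace BoundaryTriplet

variable {X : Type*} [NormedAddCommGroup X] [InnerProductSpace ℂ X]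
  {B : Type*} [NormedAddCommGroup B] [InnerProductSpace ℂ B] {T : X →ₗ.[ℂ] X}

/-- The restriction of `T` to the vectors whose boundary values lie in `C`, as a relation. -/
def restrictRel (BT : BoundaryTriplet B T) (C : Submodule ℂ (B × B)) : Submodule ℂ (X × X) :=
  (C.comap (BT.B₁.prod BT.B₂)).map (T.domain.subtype.prod T.toFun)

theorem mem_restrictRel (BT : BoundaryTriplet B T) {C : Submodule ℂ (B × B)} {r : X × X} :
    r ∈ BT.restrictRel C ↔
      ∃ x : T.domain, (BT.B₁ x, BT.B₂ x) ∈ C ∧ ((x : X), T x) = r :=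
  Iff.rfl

theorem coe_mem_restrictRel (BT : BoundaryTriplet B T) {C : Submodule ℂ (B × B)} {x : T.domain} :
    ((x : X), T x) ∈ BT.restrictRel C ↔ (BT.B₁ x, BT.B₂ x) ∈ C := by
  refine BT.mem_restrictRel.trans ⟨?_, fun h => ⟨x, h, rfl⟩⟩
  rintro ⟨y, hy, hyx⟩
  rwa [Subtype.ext (Prod.ext_iff.1 hyx).1] at hy

theorem restrictRel_mono (BT : BoundaryTriplet B T) {C C' : Submodule ℂ (B × B)} (h : C ≤ C') :
    BT.restrictRel C ≤ BT.restrictRel C' :=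
  Submodule.map_mono (Submodule.comap_mono h)

theorem restrictRel_injective (BT : BoundaryTriplet B T) :
    Function.Injective BT.restrictRel := by
  intro C C' h
  ext b
  obtain ⟨x, rfl⟩ := BT.surjective b
  rw [← BT.coe_mem_restrictRel, h, BT.coe_mem_restrictRel]

theorem re_inner_eq (BT : BoundaryTriplet B T) (x : T.domain) :
    (⟪(x : X), T x⟫ : ℂ).re = (⟪BT.B₁ x, BT.B₂ x⟫ : ℂ).re := by
  have h := congrArg Complex.re (BT.green x x)
  have h₁ : (⟪T x, (x : X)⟫ : ℂ).re = (⟪(x : X), T x⟫ : ℂ).re :=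
    inner_re_symm (𝕜 := ℂ) _ _
  have h₂ : (⟪BT.B₂ x, BT.B₁ x⟫ : ℂ).re = (⟪BT.B₁ x, BT.B₂ x⟫ : ℂ).re :=
    inner_re_symm (𝕜 := ℂ) _ _
  simp only [Complex.add_re] at h
  linarith

theorem isDissipativeRel_restrictRel_iff (BT : BoundaryTriplet B T)
    (C : Submodule ℂ (B × B)) :
    IsDissipativeRel (BT.restrictRel C) ↔ IsDissipativeRel C := by
  constructor
  · intro h b hb
    obtain ⟨x, rfl⟩ := BT.surjective b
    exact (BT.re_inner_eq x).symm.trans_le (h _ (BT.coe_mem_restrictRel.2 hb))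
  · rintro h _ ⟨x, hx, rfl⟩
    exact (BT.re_inner_eq x).trans_le (h _ hx)

theorem exists_eq_restrictRel (BT : BoundaryTriplet B T) {C : Submodule ℂ (B × B)}
    {R : Submodule ℂ (X × X)} (hCR : BT.restrictRel C ≤ R) (hR : R ≤ T.graph) :
    ∃ C', R = BT.restrictRel C' := by
  refine ⟨(R.comap (T.domain.subtype.prod T.toFun)).map (BT.B₁.prod BT.B₂),
    le_antisymm (fun r hr => ?_) ?_⟩
  · obtain ⟨x, rfl⟩ := T.mem_graph_iff'.1 (hR hr)
    exact BT.coe_mem_restrictRel.2 ⟨x, hr, rfl⟩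
  · rintro _ ⟨x, ⟨y, hy, hyx⟩, rfl⟩
    have hxy : (((x - y : T.domain) : X), T (x - y)) ∈ R := by
      refine hCR (BT.coe_mem_restrictRel.2 ?_)
      have h : (BT.B₁.prod BT.B₂) (x - y) = 0 := by rw [map_sub, hyx, sub_self]
      exact (show (BT.B₁ (x - y), BT.B₂ (x - y)) = 0 from h) ▸ C.zero_mem
    have hsum := map_add (T.domain.subtype.prod T.toFun) (x - y) y
    rw [sub_add_cancel] at hsum
    exact hsum ▸ R.add_mem hxy hy

variable [CompleteSpace X] {A₀ : X →ₗ.[ℂ] X}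

theorem neg_mem_restrictRel (BT : BoundaryTriplet B A₀.adjoint)
    (hdense : Dense (A₀.domain : Set X))
    (hskew : ∀ x : A₀.domain, (⟪A₀ x, (x : X)⟫ : ℂ).re = 0) (C : Submodule ℂ (B × B))
    (x : A₀.domain) : ((x : X), -A₀ x) ∈ BT.restrictRel C := by
  obtain ⟨y, hyx, hy⟩ := LinearPMap.exists_adjoint_eq_neg_of_skew hdense hskew x
  rw [← hyx, ← hy, BT.coe_mem_restrictRel]
  have hgreen (z : A₀.adjoint.domain) :
      (⟪BT.B₁ y, BT.B₂ z⟫ : ℂ) + ⟪BT.B₂ y, BT.B₁ z⟫ = 0 := by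
    rw [← BT.green, hy, hyx, inner_neg_left, neg_add_eq_zero,
      (LinearPMap.adjoint_isFormalAdjoint hdense).symm x z]
  obtain ⟨z, hz⟩ := BT.surjective (BT.B₂ y, BT.B₁ y)
  obtain ⟨hz₁, hz₂⟩ := Prod.ext_iff.1 hz
  have h := congrArg Complex.re (hgreen z)
  simp only at hz₁ hz₂
  rw [hz₁, hz₂, Complex.add_re] at h
  have h₁ := inner_self_nonneg (𝕜 := ℂ) (x := BT.B₁ y)
  have h₂ := inner_self_nonneg (𝕜 := ℂ) (x := BT.B₂ y)
  simp only [RCLike.re_to_complex] at h₁ h₂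
  have hB₁ : BT.B₁ y = 0 := (re_inner_self_nonpos (𝕜 := ℂ)).1 <| by
    simp only [RCLike.re_to_complex]; simp only [Complex.zero_re] at h; linarith
  have hB₂ : BT.B₂ y = 0 := (re_inner_self_nonpos (𝕜 := ℂ)).1 <| by
    simp only [RCLike.re_to_complex]; simp only [Complex.zero_re] at h; linarith
  rw [hB₁, hB₂]
  exact C.zero_mem

theorem isMaximalDissipativeRel_restrictRel_iff (BT : BoundaryTriplet B A₀.adjoint)
    (hdense : Dense (A₀.domain : Set X))
    (hskew : ∀ x : A₀.domain, (⟪A₀ x, (x : X)⟫ : ℂ).re = 0) (C : Submodule ℂ (B × B)) :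
    IsMaximalDissipativeRel (BT.restrictRel C) ↔ IsMaximalDissipativeRel C := by
  refine and_congr (BT.isDissipativeRel_restrictRel_iff C) ⟨fun h C' hC' hle => ?_,
    fun h R hR hle => ?_⟩
  · exact BT.restrictRel_injective
      (h _ ((BT.isDissipativeRel_restrictRel_iff C').2 hC') (BT.restrictRel_mono hle))
  · obtain ⟨C', rfl⟩ := BT.exists_eq_restrictRel hle
      (hR.le_graph_adjoint hdense hskew fun x => hle (BT.neg_mem_restrictRel hdense hskew C x))
    rw [h C' ((BT.isDissipativeRel_restrictRel_iff C').1 hR) fun b hb => ?_]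
    obtain ⟨x, rfl⟩ := BT.surjective b
    exact BT.coe_mem_restrictRel.1 (hle (BT.coe_mem_restrictRel.2 hb))

end BoundaryTriplet

theorem LinearPMap.graph_domRestrict_map_subtype {E F : Type*} [AddCommGroup E] [Module ℂ E]
    [AddCommGroup F] [Module ℂ F] (T : E →ₗ.[ℂ] F) (S : Submodule ℂ T.domain) :
    (T.domRestrict (S.map T.domain.subtype)).graph =
      S.map (T.domain.subtype.prod T.toFun) := by
  ext r
  rw [LinearPMap.mem_graph_iff']
  constructor
  · rintro ⟨⟨_, ⟨x, hx, rfl⟩, hxT⟩, rfl⟩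
    exact ⟨x, hx, Prod.ext rfl (LinearPMap.domRestrict_apply rfl).symm⟩
  · rintro ⟨x, hx, rfl⟩
    exact ⟨⟨x, ⟨x, hx, rfl⟩, x.2⟩, Prod.ext rfl (LinearPMap.domRestrict_apply rfl)⟩

/-- With `A` the restriction of `A₀*` to `{x : W₁ B₁ x + W₂ B₂ x = 0}`,
`A` generates a contraction semigroup (equivalently, being closed and densely defined,
`A` is maximal dissipative) iff `A` is dissipative and `W₁ W₂* + W₂ W₁* ≥ 0`. -/
theorem statement10
    {X : Type*} [NormedAddCommGroup X] [InnerProductSpace ℂ X] [CompleteSpace X]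
    {B : Type*} [NormedAddCommGroup B] [InnerProductSpace ℂ B] [CompleteSpace B]
    {K : Type*} [NormedAddCommGroup K] [InnerProductSpace ℂ K] [CompleteSpace K]
    (A₀ : X →ₗ.[ℂ] X) (hdense : Dense (A₀.domain : Set X)) (hclosed : A₀.IsClosed)
    (hskew : ∀ x : A₀.domain, (⟪A₀ x, (x : X)⟫ : ℂ).re = 0)
    (BT : BoundaryTriplet B A₀.adjoint)
    (W₁ W₂ : B →L[ℂ] K)
    (A : X →ₗ.[ℂ] X)
    (hA : A = A₀.adjoint.domRestrict
      ((LinearMap.ker ((W₁ : B →ₗ[ℂ] K) ∘ₗ BT.B₁ + (W₂ : B →ₗ[ℂ] K) ∘ₗ BT.B₂)).map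
        A₀.adjoint.domain.subtype))
    : IsMaximalDissipativeRel A.graph ↔
        (IsDissipativeRel A.graph ∧
          ∀ k : K, 0 ≤ (⟪ContinuousLinearMap.adjoint W₂ k,
            ContinuousLinearMap.adjoint W₁ k⟫ : ℂ).re) := by
  have hgraph : A.graph = BT.restrictRel (W₁.coprod W₂).ker := by
    rw [hA, LinearPMap.graph_domRestrict_map_subtype]
    rfl
  rw [hgraph, BT.isMaximalDissipativeRel_restrictRel_iff hdense hskew,
    BT.isDissipativeRel_restrictRel_iff, isMaximalDissipativeRel_ker_coprod_iff]
end
end
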